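/- Let γ, δ, m, d be positive integers and let B be an integer with B > (γ+δ)·(m−1). Let a = Σ_{i=0}^{d−1} a_i·B^i, b = Σ_{i=0}^{d−1} b_i·B^i, c = Σ_{i=0}^{d−1} c_i·B^i, where all digits a_i, b_i, c_i are integers with 0 ≤ a_i, b_i, c_i < m. If γ·a + δ·b = (γ+δ)·c, then γ·a_i + δ·b_i = (γ+δ)·c_i for every i with 0 ≤ i ≤ d−1. -/

import Mathlib

/-- A base-`B` expansion of zero whose signed digits are smaller than `B` in absolute value has
only zero digits. -/
theorem digits_eq_zero_of_sum_mul_pow_eq_zero {B : ℤ} {d : ℕ} (x : Fin d → ℤ)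
    (hx : ∀ i, |x i| < B) (h : ∑ i, x i * B ^ (i : ℕ) = 0) (i : Fin d) : x i = 0 := by
  induction d with
  | zero => exact i.elim0
  | succ n ih =>
    have hB : B ≠ 0 := ((abs_nonneg _).trans_lt (hx 0)).ne'
    have hsum : x 0 + B * ∑ j : Fin n, x j.succ * B ^ (j : ℕ) = 0 := by
      rw [← h, Fin.sum_univ_succ, Finset.mul_sum]
      simp only [Fin.val_zero, pow_zero, mul_one, Fin.val_succ, pow_succ]
      congr 1
      exact Finset.sum_congr rfl fun j _ => by ring
    have h0 : x 0 = 0 :=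
      Int.eq_zero_of_abs_lt_dvd ((Dvd.intro _ rfl : B ∣ B * _).neg_right.trans
        (eq_neg_of_add_eq_zero_left hsum).symm.dvd) (hx 0)
    have htail : ∑ j : Fin n, x j.succ * B ^ (j : ℕ) = 0 := by
      simpa [h0, hB] using hsum
    exact Fin.cases h0 (ih (fun j => x j.succ) (fun j => hx j.succ) htail) i

theorem stmt_1 (γ δ : ℤ) (hγ : 0 < γ) (hδ : 0 < δ) (m : ℤ) (hm : 0 < m) (d : ℕ) (hd : 0 < d)
    (B : ℤ) (hB : (γ + δ) * (m - 1) < B)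
    (a b c : Fin d → ℤ)
    (ha : ∀ i, 0 ≤ a i ∧ a i < m)
    (hb : ∀ i, 0 ≤ b i ∧ b i < m)
    (hc : ∀ i, 0 ≤ c i ∧ c i < m)
    (h : γ * (∑ i, a i * B ^ (i : ℕ)) + δ * (∑ i, b i * B ^ (i : ℕ))
        = (γ + δ) * (∑ i, c i * B ^ (i : ℕ))) :
    ∀ i, γ * a i + δ * b i = (γ + δ) * c i := by
  intro i
  refine sub_eq_zero.mp (digits_eq_zero_of_sum_mul_pow_eq_zero (B := B)
    (fun j => γ * a j + δ * b j - (γ + δ) * c j) (fun j => ?_) ?_ i)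
  · obtain ⟨ha₀, ham⟩ := ha j
    obtain ⟨hb₀, hbm⟩ := hb j
    obtain ⟨hc₀, hcm⟩ := hc j
    have ha' : γ * a j ≤ γ * (m - 1) := by gcongr; omega
    have hb' : δ * b j ≤ δ * (m - 1) := by gcongr; omega
    have hc' : (γ + δ) * c j ≤ (γ + δ) * (m - 1) := by gcongr; omega
    have hγa : 0 ≤ γ * a j := by positivity
    have hδb : 0 ≤ δ * b j := by positivity
    have hγδc : 0 ≤ (γ + δ) * c j := by positivity
    rw [abs_lt]
    constructor <;> linarith
  · rw [← sub_eq_zero.mpr h]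
    simp only [Finset.mul_sum, ← Finset.sum_add_distrib, ← Finset.sum_sub_distrib]
    exact Finset.sum_congr rfl fun j _ => by ring
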